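/- arXiv:2407.20142 — 7 statements merged into one kernel-verified Lean document; each statement's English description precedes it below -/
import Mathlib

section
/- (Theorem 1, specialized to the Pauli-z Hamiltonian and the weight matrix W̄) Let N ≥ 1 and 0 < α < 1, and let ψ be an N-qubit pure state whose QFIM F(ψ) is positive definite. Then Tr(W̄·F(ψ)⁻¹) ≥ 4N. -/
open scoped BigOperators

/-- Sign of a qubit basis label: `ε(0) = 1`, `ε(1) = −1`. -/
def qubitSign : Fin 2 → ℝ := fun b => if b = 0 then 1 else -1

/-- Pauli-z expectation `E_ψ[Z_i] = Σ_x ε(x i) |ψ x|²` of an `N`-qubit state. -/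
noncomputable def expZ {N : ℕ} (ψ : (Fin N → Fin 2) → ℂ) (i : Fin N) : ℝ :=
  ∑ x : Fin N → Fin 2, qubitSign (x i) * ‖ψ x‖ ^ 2

/-- Pauli-z correlator `E_ψ[Z_i Z_j] = Σ_x ε(x i) ε(x j) |ψ x|²`. -/
noncomputable def expZZ {N : ℕ} (ψ : (Fin N → Fin 2) → ℂ) (i j : Fin N) : ℝ :=
  ∑ x : Fin N → Fin 2, qubitSign (x i) * qubitSign (x j) * ‖ψ x‖ ^ 2

/-- Quantum Fisher information matrix of the pure probe `ψ` for estimating the `N`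
independent field strengths of the Hamiltonian `H = ħ Σ_i h_i σ_z^i`:
`F_ii = 4(1 − E_ψ[Z_i]²)` and `F_ij = 4(E_ψ[Z_i Z_j] − E_ψ[Z_i] E_ψ[Z_j])` for `i ≠ j`. -/
noncomputable def qfim {N : ℕ} (ψ : (Fin N → Fin 2) → ℂ) : Matrix (Fin N) (Fin N) ℝ :=
  Matrix.of fun i j =>
    if i = j then 4 * (1 - expZ ψ i ^ 2)
    else 4 * (expZZ ψ i j - expZ ψ i * expZ ψ j)

/-- The weight matrix `W̄ = a·I + b·(J − I)` with `a = 16[(N−1)α² + 1]`,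
`b = 16[(N−2)α² + 2α]`, `J` the all-ones matrix. -/
noncomputable def weightW (N : ℕ) (α : ℝ) : Matrix (Fin N) (Fin N) ℝ :=
  (16 * (((N : ℝ) - 1) * α ^ 2 + 1)) • (1 : Matrix (Fin N) (Fin N) ℝ)
    + (16 * (((N : ℝ) - 2) * α ^ 2 + 2 * α)) •
        ((Matrix.of fun _ _ => (1 : ℝ)) - (1 : Matrix (Fin N) (Fin N) ℝ))

/-- Completing the square: for symmetric `M` and positive definite `F`,
`Tr(M² F⁻¹) ≥ 2t Tr M − t² Tr F` for every real `t`. -/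
theorem Matrix.PosDef.trace_mul_self_mul_inv_ge {n : Type*} [Fintype n] [DecidableEq n]
    {F M : Matrix n n ℝ} (hF : F.PosDef) (hM : M.IsSymm) (t : ℝ) :
    2 * t * M.trace - t ^ 2 * F.trace ≤ (M * M * F⁻¹).trace := by
  have hFt : Matrix.transpose F = F := by simpa using hF.isHermitian.eq
  have hdet : IsUnit F.det := (Matrix.isUnit_iff_isUnit_det F).mp hF.isUnit
  have hpsd := (hF.inv.posSemidef.conjTranspose_mul_mul_same (M - t • F)).trace_nonneg
  have hsq : (M - t • F).conjTranspose * F⁻¹ * (M - t • F)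
      = M * F⁻¹ * M - (2 * t) • M + t ^ 2 • F := by
    rw [Matrix.conjTranspose_eq_transpose_of_trivial, Matrix.transpose_sub,
      Matrix.transpose_smul, hM.eq, hFt]
    simp only [Matrix.sub_mul, Matrix.mul_sub, Matrix.smul_mul, Matrix.mul_smul,
      Matrix.mul_nonsing_inv _ hdet, Matrix.one_mul, Matrix.nonsing_inv_mul_cancel_right _ _ hdet]
    module
  have hcyc : (M * F⁻¹ * M).trace = (M * M * F⁻¹).trace := by
    rw [Matrix.trace_mul_comm, Matrix.mul_assoc]
  rw [hsq, Matrix.trace_add, Matrix.trace_sub, Matrix.trace_smul, Matrix.trace_smul, hcyc,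
    smul_eq_mul, smul_eq_mul] at hpsd
  linarith

theorem trace_qfim_le {N : ℕ} (ψ : (Fin N → Fin 2) → ℂ) : (qfim ψ).trace ≤ 4 * (N : ℝ) := by
  calc (qfim ψ).trace ≤ ∑ _i : Fin N, (4 : ℝ) :=
        Finset.sum_le_sum fun i _ => by
          simp only [qfim, Matrix.diag_apply, Matrix.of_apply, if_true]
          nlinarith [sq_nonneg (expZ ψ i)]
    _ = 4 * (N : ℝ) := by simp [mul_comm]

/-- The matrix `(1 − α) I + α J`, whose square is `W̄ / 16`. -/
def weightRoot (N : ℕ) (α : ℝ) : Matrix (Fin N) (Fin N) ℝ :=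
  Matrix.of fun i j => if i = j then 1 else α

theorem weightRoot_isSymm (N : ℕ) (α : ℝ) : (weightRoot N α).IsSymm := by
  ext i j
  simp [weightRoot, eq_comm]

theorem trace_weightRoot (N : ℕ) (α : ℝ) : (weightRoot N α).trace = N := by
  simp [weightRoot, Matrix.trace]

theorem weightW_eq_smul_weightRoot_mul_self (N : ℕ) (α : ℝ) :
    weightW N α = (16 : ℝ) • (weightRoot N α * weightRoot N α) := by
  ext i j
  have hentry : ∀ k l : Fin N, weightRoot N α k l = α + (1 - α) * if k = l then 1 else 0 := by
    intro k l
    by_cases h : k = l <;> simp [weightRoot, h]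
  simp only [Matrix.smul_apply, Matrix.mul_apply, hentry, smul_eq_mul, mul_add, add_mul,
    Finset.sum_add_distrib]
  by_cases h : i = j <;> simp [weightW, h] <;> ring

/-- Theorem 1 specialized to the Pauli-z Hamiltonian `H = ħ Σ_i h_i σ_z^i` and the
weight matrix `W̄`: for any `N`-qubit pure probe `ψ` with positive definite QFIM,
`Tr(W̄ F(ψ)⁻¹) ≥ 4N`. -/
theorem trace_weightW_qfim_inv_ge_four_N
    {N : ℕ} (hN : 1 ≤ N) (α : ℝ) (hα0 : 0 < α) (hα1 : α < 1)
    (ψ : (Fin N → Fin 2) → ℂ) (hψ : ∑ x : Fin N → Fin 2, ‖ψ x‖ ^ 2 = 1)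
    (hpd : (qfim ψ).PosDef) :
    4 * (N : ℝ) ≤ Matrix.trace (weightW N α * (qfim ψ)⁻¹) := by
  have hroot := hpd.trace_mul_self_mul_inv_ge (weightRoot_isSymm N α) (1 / 4)
  rw [trace_weightRoot] at hroot
  rw [weightW_eq_smul_weightRoot_mul_self, Matrix.smul_mul, Matrix.trace_smul, smul_eq_mul]
  linarith [trace_qfim_le ψ]
end

section
/- (Theorem 2) Let N ≥ 2 and 0 < α < 1, and let ψ be an N-qubit pure state satisfying E_ψ[Z_i] = 0 for all i and E_ψ[Z_i Z_j] = α for all i ≠ j (equivalently, whose QFIM equals F(ψ) = 4(I + α(J − I)) = W̄^{1/2}, the condition for attaining the optimal precision Tr(W̄·F⁻¹) = 4N). Then ψ is genuinely multipartite entangled: for every subset S of the qubits with S nonempty and S not equal to the full set, there do NOT exist functions φ₁ : (S → Fin 2) → ℂ and φ₂ : (Sᶜ → Fin 2) → ℂ with ψ(x) = φ₁(x restricted to S)·φ₂(x restricted to Sᶜ) for all x. -/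
open scoped BigOperators

/-- Restricting a configuration to `S` and to `Sᶜ` is a bijection onto pairs of configurations. -/
theorem bijective_restrict_prod_restrict_compl {ι β : Type*} [Fintype ι] [DecidableEq ι]
    (S : Finset ι) :
    Function.Bijective fun x : ι → β =>
      ((fun k => x k : S → β), (fun k => x k : (Sᶜ : Finset ι) → β)) := by
  refine ⟨fun x y h => ?_, fun ⟨u, v⟩ => ?_⟩
  · obtain ⟨hu, hv⟩ := Prod.mk.inj h
    funext k
    by_cases hk : k ∈ S
    · exact congrFun hu ⟨k, hk⟩
    · exact congrFun hv ⟨k, Finset.mem_compl.mpr hk⟩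
  · refine ⟨fun k => if hk : k ∈ S then u ⟨k, hk⟩ else v ⟨k, Finset.mem_compl.mpr hk⟩, ?_⟩
    refine Prod.ext (funext fun k => ?_) (funext fun k => ?_)
    · simp [k.2]
    · simp [Finset.mem_compl.mp k.2]

/-- A sum over all configurations of a product of a function of the coordinates in `S` and a
function of the remaining coordinates factorizes. -/
theorem sum_mul_restrict_compl {ι β R : Type*} [Fintype ι] [DecidableEq ι] [Fintype β]
    [NonUnitalNonAssocSemiring R] (S : Finset ι) (f : (S → β) → R)
    (g : ((Sᶜ : Finset ι) → β) → R) :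
    ∑ x : ι → β, f (fun k => x k) * g (fun k => x k) = (∑ u, f u) * ∑ v, g v := by
  rw [Fintype.sum_mul_sum, ← Fintype.sum_prod_type']
  exact Fintype.sum_bijective _ (bijective_restrict_prod_restrict_compl S) _ _ fun _ => rfl

/-- Across a bipartition along which the state factorizes, the unnormalized correlator
satisfies `⟨Z_i Z_j⟩ ⟨1⟩ = ⟨Z_i⟩ ⟨Z_j⟩`. -/
theorem expZZ_mul_norm_sq_of_factorizes {N : ℕ} (ψ : (Fin N → Fin 2) → ℂ) (S : Finset (Fin N))
    (φ₁ : (S → Fin 2) → ℂ) (φ₂ : ((Sᶜ : Finset (Fin N)) → Fin 2) → ℂ)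
    (h : ∀ x : Fin N → Fin 2, ψ x = φ₁ (fun k => x k) * φ₂ (fun k => x k))
    {i j : Fin N} (hi : i ∈ S) (hj : j ∈ Sᶜ) :
    expZZ ψ i j * ∑ x, ‖ψ x‖ ^ 2 = expZ ψ i * expZ ψ j := by
  let P : (S → Fin 2) → ℝ := fun u => ‖φ₁ u‖ ^ 2
  let Q : ((Sᶜ : Finset (Fin N)) → Fin 2) → ℝ := fun v => ‖φ₂ v‖ ^ 2
  let P' : (S → Fin 2) → ℝ := fun u => qubitSign (u ⟨i, hi⟩) * P u
  let Q' : ((Sᶜ : Finset (Fin N)) → Fin 2) → ℝ := fun v => qubitSign (v ⟨j, hj⟩) * Q v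
  have hsq (x : Fin N → Fin 2) : ‖ψ x‖ ^ 2 = P (fun k => x k) * Q (fun k => x k) := by
    rw [h, norm_mul, mul_pow]
  have h1 : ∑ x, ‖ψ x‖ ^ 2 = (∑ u, P u) * ∑ v, Q v := by
    rw [← sum_mul_restrict_compl]
    exact Finset.sum_congr rfl fun x _ => hsq x
  have hZi : expZ ψ i = (∑ u, P' u) * ∑ v, Q v := by
    rw [← sum_mul_restrict_compl, expZ]
    refine Finset.sum_congr rfl fun x _ => ?_
    rw [hsq]
    ring
  have hZj : expZ ψ j = (∑ u, P u) * ∑ v, Q' v := by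
    rw [← sum_mul_restrict_compl, expZ]
    refine Finset.sum_congr rfl fun x _ => ?_
    rw [hsq]
    ring
  have hZZ : expZZ ψ i j = (∑ u, P' u) * ∑ v, Q' v := by
    rw [← sum_mul_restrict_compl, expZZ]
    refine Finset.sum_congr rfl fun x _ => ?_
    rw [hsq]
    ring
  rw [h1, hZi, hZj, hZZ]
  ring

/-- Theorem 2: an `N`-qubit pure state `ψ` with `E_ψ[Z_i] = 0` for all `i` and
`E_ψ[Z_i Z_j] = α` for all `i ≠ j` (the condition `F(ψ) = W̄^{1/2}` for attaining
the optimal precision `Tr(W̄ F⁻¹) = 4N`) is genuinely multipartite entangled: it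
does not factorize across any nontrivial bipartition `S | Sᶜ` of the qubits. -/
theorem genuine_multipartite_entanglement_of_optimal_probe
    {N : ℕ} (hN : 2 ≤ N) (α : ℝ) (hα0 : 0 < α) (hα1 : α < 1)
    (ψ : (Fin N → Fin 2) → ℂ) (hψ : ∑ x : Fin N → Fin 2, ‖ψ x‖ ^ 2 = 1)
    (hZ : ∀ i, expZ ψ i = 0)
    (hZZ : ∀ i j, i ≠ j → expZZ ψ i j = α) :
    ∀ S : Finset (Fin N), S.Nonempty → S ≠ Finset.univ →
      ¬ ∃ (φ₁ : (S → Fin 2) → ℂ) (φ₂ : ((Sᶜ : Finset (Fin N)) → Fin 2) → ℂ),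
        ∀ x : Fin N → Fin 2,
          ψ x = φ₁ (fun k => x k) * φ₂ (fun k => x k) := by
  rintro S ⟨i, hi⟩ hS ⟨φ₁, φ₂, h⟩
  obtain ⟨j, hj⟩ : ∃ j, j ∉ S := by
    simpa [Finset.eq_univ_iff_forall] using hS
  have hij : i ≠ j := fun e => hj (e ▸ hi)
  have key := expZZ_mul_norm_sq_of_factorizes ψ S φ₁ φ₂ h hi (Finset.mem_compl.mpr hj)
  rw [hψ, hZZ i j hij, hZ i, mul_one, zero_mul] at key
  exact hα0.ne' key
end

section
/- (Theorem 3) Let N ≥ 2, 0 < α < 1, and let θ be a real number with cos²θ = α. Define the generalized GHZ state ψ : (Fin N → Fin 2) → ℂ by ψ(x) = (∏_i f(x i) + i·∏_i g(x i))/√2, where f(0) = cos(θ/2), f(1) = sin(θ/2), g(0) = −sin(θ/2), g(1) = cos(θ/2) (this is the GHZ state (|ψ⟩^{⊗N} + e^{iφ}|ψ^⊥⟩^{⊗N})/√2 with relative phase φ = π/2). Then ψ is a unit vector, E_ψ[Z_i] = 0 for all i, and E_ψ[Z_i Z_j] = α for all i ≠ j; hence ψ satisfies the conditions for saturating the optimal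 precision bound for the Hamiltonian H = ħ Σ_i h_i σ_z^i and weight matrix W̄. -/
open scoped BigOperators

/-- Expectation of a function of coordinate `i` under a product weight. -/
lemma sum_mul_prod_of_sum_eq_one {ι κ : Type*} [Fintype ι] [DecidableEq ι] [Fintype κ]
    (u : κ → ℝ) (hu : ∑ b, u b = 1) (a : κ → ℝ) (i : ι) :
    ∑ x : ι → κ, a (x i) * ∏ k, u (x k) = ∑ b, a b * u b := by
  have h : ∀ x : ι → κ, a (x i) * ∏ k, u (x k) =
      ∏ k, (if k = i then a (x k) else 1) * u (x k) := fun x => by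
    rw [Finset.prod_mul_distrib]; simp
  simp_rw [h]
  rw [← Fintype.prod_sum (fun k b => (if k = i then a b else 1) * u b),
    Finset.prod_eq_single i]
  · simp
  · intro k _ hk
    simpa [hk] using hu
  · simp

/-- Under a product weight, functions of distinct coordinates are uncorrelated. -/
lemma sum_mul_mul_prod_of_sum_eq_one {ι κ : Type*} [Fintype ι] [DecidableEq ι] [Fintype κ]
    (u : κ → ℝ) (hu : ∑ b, u b = 1) (a c : κ → ℝ) {i j : ι} (hij : i ≠ j) :
    ∑ x : ι → κ, a (x i) * c (x j) * ∏ k, u (x k) =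
      (∑ b, a b * u b) * ∑ b, c b * u b := by
  have h : ∀ x : ι → κ, a (x i) * c (x j) * ∏ k, u (x k) =
      ∏ k, (if k = i then a (x k) else 1) * (if k = j then c (x k) else 1) * u (x k) :=
    fun x => by
      rw [Finset.prod_mul_distrib, Finset.prod_mul_distrib]; simp
  simp_rw [h]
  rw [← Fintype.prod_sum
      (fun k b => (if k = i then a b else 1) * (if k = j then c b else 1) * u b),
    Finset.prod_eq_mul i j hij]
  · simp [hij, hij.symm]
  · rintro k _ ⟨hki, hkj⟩
    simpa [hki, hkj] using hu
  · simp
  · simp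

/-- The Born weights of `(|p⟩^{⊗ι} + i|q⟩^{⊗ι})/√2` with real `p`, `q` have no interference
term. -/
lemma norm_sq_add_I_mul_div_sqrt_two {ι κ : Type*} [Fintype ι] (p q : κ → ℝ) (x : ι → κ) :
    ‖((∏ k, (p (x k) : ℂ)) + Complex.I * ∏ k, (q (x k) : ℂ)) / (Real.sqrt 2 : ℂ)‖ ^ 2 =
      (∏ k, p (x k) ^ 2 + ∏ k, q (x k) ^ 2) / 2 := by
  rw [norm_div, div_pow, Complex.norm_real, Real.norm_eq_abs, sq_abs,
    Real.sq_sqrt zero_le_two, Finset.prod_pow, Finset.prod_pow, ← Complex.ofReal_prod,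
    ← Complex.ofReal_prod, mul_comm Complex.I, ← Complex.normSq_eq_norm_sq,
    Complex.normSq_add_mul_I]

/-- Theorem 3: the generalized GHZ state
`(|ψ⟩^{⊗N} + e^{iπ/2}|ψ^⊥⟩^{⊗N})/√2` with `|ψ⟩ = cos(θ/2)|0⟩ + sin(θ/2)|1⟩`,
`|ψ^⊥⟩ = −sin(θ/2)|0⟩ + cos(θ/2)|1⟩` and `cos²θ = α` is a unit vector with
`E_ψ[Z_i] = 0` for all `i` and `E_ψ[Z_i Z_j] = α` for all `i ≠ j`; hence it
saturates the optimal precision bound for `H = ħ Σ_i h_i σ_z^i` and `W̄`. -/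
theorem ghz_state_saturates_bound
    {N : ℕ} (hN : 2 ≤ N) (α : ℝ) (hα0 : 0 < α) (hα1 : α < 1)
    (θ : ℝ) (hθ : Real.cos θ ^ 2 = α)
    (f g : Fin 2 → ℂ)
    (hf0 : f 0 = (Real.cos (θ / 2) : ℂ)) (hf1 : f 1 = (Real.sin (θ / 2) : ℂ))
    (hg0 : g 0 = (-(Real.sin (θ / 2)) : ℂ)) (hg1 : g 1 = (Real.cos (θ / 2) : ℂ))
    (ψ : (Fin N → Fin 2) → ℂ)
    (hψdef : ∀ x : Fin N → Fin 2,
      ψ x = ((∏ i, f (x i)) + Complex.I * ∏ i, g (x i)) / (Real.sqrt 2 : ℂ)) :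
    (∑ x : Fin N → Fin 2, ‖ψ x‖ ^ 2 = 1) ∧
    (∀ i, expZ ψ i = 0) ∧
    (∀ i j, i ≠ j → expZZ ψ i j = α) := by
  set c := Real.cos (θ / 2) with hc
  set s := Real.sin (θ / 2) with hs
  have hcs : c ^ 2 + s ^ 2 = 1 := Real.cos_sq_add_sin_sq (θ / 2)
  have hcos : Real.cos θ = c ^ 2 - s ^ 2 := by
    rw [hc, hs, ← Real.cos_two_mul', mul_div_cancel₀ θ two_ne_zero]
  have hf : ∀ b, f b = ((![c, s] b : ℝ) : ℂ) := by
    intro b; fin_cases b <;> simp [hf0, hf1]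
  have hg : ∀ b, g b = ((![-s, c] b : ℝ) : ℂ) := by
    intro b; fin_cases b <;> simp [hg0, hg1]
  have hnorm : ∀ x, ‖ψ x‖ ^ 2 =
      (∏ k, ![c, s] (x k) ^ 2 + ∏ k, ![-s, c] (x k) ^ 2) / 2 := by
    intro x
    simp only [hψdef, hf, hg]
    exact norm_sq_add_I_mul_div_sqrt_two _ _ x
  have hu : ∑ b, ![c, s] b ^ 2 = 1 := by simpa using hcs
  have hv : ∑ b, ![-s, c] b ^ 2 = 1 := by simpa [add_comm] using hcs
  have hεu : ∑ b, qubitSign b * ![c, s] b ^ 2 = Real.cos θ := by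
    simp [qubitSign, hcos]; ring
  have hεv : ∑ b, qubitSign b * ![-s, c] b ^ 2 = -Real.cos θ := by
    simp [qubitSign, hcos]; ring
  refine ⟨?_, fun i => ?_, fun i j hij => ?_⟩
  · have h1 := sum_mul_prod_of_sum_eq_one _ hu (fun _ => 1) (⟨0, by omega⟩ : Fin N)
    have h2 := sum_mul_prod_of_sum_eq_one _ hv (fun _ => 1) (⟨0, by omega⟩ : Fin N)
    simp only [one_mul, hu, hv] at h1 h2
    simp only [hnorm]
    rw [← Finset.sum_div, Finset.sum_add_distrib, h1, h2]
    norm_num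
  · simp only [expZ, hnorm, mul_div_assoc', mul_add]
    rw [← Finset.sum_div, Finset.sum_add_distrib, sum_mul_prod_of_sum_eq_one _ hu,
      sum_mul_prod_of_sum_eq_one _ hv, hεu, hεv]
    ring
  · simp only [expZZ, hnorm, mul_div_assoc', mul_add]
    rw [← Finset.sum_div, Finset.sum_add_distrib, sum_mul_mul_prod_of_sum_eq_one _ hu _ _ hij,
      sum_mul_mul_prod_of_sum_eq_one _ hv _ _ hij, hεu, hεv, ← hθ]
    ring
end

section
/- Let N ≥ 1 and 0 < α < 1, and let ψ be an N-qubit pure state with E_ψ[Z_i] = 0 for all i and E_ψ[Z_i Z_j] = α for all i ≠ j. Then the QFIM of ψ equals F(ψ) = 4(I + α(J − I)); this matrix is positive definite (invertible), and Tr(W̄·F(ψ)⁻¹) = 4N, so ψ attains the optimized precision bound of Theorem 1 for the weight matrix W̄. -/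
open scoped BigOperators

/-- The equicorrelation matrix `I + α(J − I)` is positive definite for `0 ≤ α < 1`. -/
theorem posDef_one_add_smul_ones_sub_one {n : Type*} [Fintype n] [DecidableEq n] {α : ℝ}
    (hα0 : 0 ≤ α) (hα1 : α < 1) :
    ((1 : Matrix n n ℝ) + α • ((Matrix.of fun _ _ => (1 : ℝ)) - (1 : Matrix n n ℝ))).PosDef := by
  have hJ : (Matrix.of fun _ _ => (1 : ℝ) : Matrix n n ℝ).PosSemidef := by
    convert Matrix.posSemidef_vecMulVec_self_star (fun _ : n => (1 : ℝ)) using 1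
    ext i j
    simp [Matrix.vecMulVec_apply]
  have h := (Matrix.PosDef.one (n := n) (R := ℝ)).smul (sub_pos.2 hα1)
  convert h.add_posSemidef (hJ.smul hα0) using 1
  module

/-- The weight matrix is the square of `4(I + α(J − I))`. -/
theorem weightW_eq_mul_self (N : ℕ) (α : ℝ) :
    weightW N α =
      ((4 : ℝ) • ((1 : Matrix (Fin N) (Fin N) ℝ)
        + α • ((Matrix.of fun _ _ => (1 : ℝ)) - (1 : Matrix (Fin N) (Fin N) ℝ)))) *
      ((4 : ℝ) • ((1 : Matrix (Fin N) (Fin N) ℝ)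
        + α • ((Matrix.of fun _ _ => (1 : ℝ)) - (1 : Matrix (Fin N) (Fin N) ℝ)))) := by
  unfold weightW
  set J : Matrix (Fin N) (Fin N) ℝ := Matrix.of fun _ _ => (1 : ℝ) with hJdef
  have hJ : J * J = (N : ℝ) • J := by
    ext i j
    simp [hJdef, Matrix.mul_apply]
  simp only [smul_mul_assoc, mul_smul_comm, mul_add, add_mul, mul_sub, sub_mul, mul_one, one_mul,
    hJ]
  module

/-- If an `N`-qubit pure state `ψ` satisfies `E_ψ[Z_i] = 0` for all `i` and
`E_ψ[Z_i Z_j] = α` for all `i ≠ j`, then its QFIM equals `4(I + α(J − I))`, this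
matrix is positive definite, and `Tr(W̄ F(ψ)⁻¹) = 4N`: `ψ` attains the optimized
precision bound of Theorem 1 for the weight matrix `W̄`. -/
theorem qfim_eq_and_trace_weightW_qfim_inv_eq_four_N
    {N : ℕ} (hN : 1 ≤ N) (α : ℝ) (hα0 : 0 < α) (hα1 : α < 1)
    (ψ : (Fin N → Fin 2) → ℂ) (hψ : ∑ x : Fin N → Fin 2, ‖ψ x‖ ^ 2 = 1)
    (hZ : ∀ i, expZ ψ i = 0)
    (hZZ : ∀ i j, i ≠ j → expZZ ψ i j = α) :
    qfim ψ = (4 : ℝ) • ((1 : Matrix (Fin N) (Fin N) ℝ)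
        + α • ((Matrix.of fun _ _ => (1 : ℝ)) - (1 : Matrix (Fin N) (Fin N) ℝ))) ∧
    (qfim ψ).PosDef ∧
    Matrix.trace (weightW N α * (qfim ψ)⁻¹) = 4 * (N : ℝ) := by
  have hF : qfim ψ = (4 : ℝ) • ((1 : Matrix (Fin N) (Fin N) ℝ)
      + α • ((Matrix.of fun _ _ => (1 : ℝ)) - (1 : Matrix (Fin N) (Fin N) ℝ))) := by
    ext i j
    by_cases hij : i = j
    · simp [qfim, hij, hZ]
    · simp [qfim, hij, hZ, hZZ i j hij]
  have hpos : (qfim ψ).PosDef := by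
    rw [hF]
    exact (posDef_one_add_smul_ones_sub_one hα0.le hα1).smul (by norm_num)
  refine ⟨hF, hpos, ?_⟩
  have hdet : IsUnit (qfim ψ).det := hpos.det_pos.ne'.isUnit
  rw [weightW_eq_mul_self, ← hF, Matrix.mul_nonsing_inv_cancel_right _ _ hdet]
  simp [Matrix.trace, qfim, hZ, mul_comm]
end

section
/- (Theorem 4) Let N ≥ 1 and 0 < α < 1. Let ψ be a fully product N-qubit pure state: ψ(x) = ∏_i φ_i(x i) where each φ_i : Fin 2 → ℂ satisfies |φ_i(0)|² + |φ_i(1)|² = 1. Then the QFIM of ψ is diagonal: F_ij = 0 for all i ≠ j and F_ii = 4(1 − E_ψ[Z_i]²); and if moreover E_ψ[Z_i]² < 1 for all i (so that F is invertible), then Tr(W̄·F(ψ)⁻¹) = Σ_i a/(4(1 − E_ψ[Z_i]²)) ≥ N·a/4 = 4N[(N−1)α² + 1]. -/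
open scoped BigOperators

/-- Under a product of normalized weights, the expectation of a product of single-site functions
over a set `S` of sites is the product of the single-site expectations. -/
theorem sum_prod_mul_prod_eq {ι κ R : Type*} [Fintype ι] [DecidableEq ι] [Fintype κ]
    [CommSemiring R] (p : ι → κ → R) (hp : ∀ i, ∑ b, p i b = 1) (g : κ → R) (S : Finset ι) :
    ∑ x : ι → κ, (∏ i ∈ S, g (x i)) * ∏ i, p i (x i) = ∏ i ∈ S, ∑ b, g b * p i b := by
  have h (x : ι → κ) : (∏ i ∈ S, g (x i)) * ∏ i, p i (x i)
      = ∏ i, (if i ∈ S then g (x i) else 1) * p i (x i) := by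
    rw [Finset.prod_mul_distrib, Finset.prod_ite_mem, Finset.univ_inter]
  simp_rw [h]
  rw [← Fintype.prod_sum fun i b => (if i ∈ S then g b else 1) * p i b]
  have h' (i : ι) : ∑ b, (if i ∈ S then g b else 1) * p i b
      = if i ∈ S then ∑ b, g b * p i b else 1 := by
    split_ifs <;> simp [hp]
  simp_rw [h', Finset.prod_ite_mem, Finset.univ_inter]

section ProductState

variable {N : ℕ} {φ : Fin N → Fin 2 → ℂ} {ψ : (Fin N → Fin 2) → ℂ}

theorem expZ_of_product (hφ : ∀ i, ‖φ i 0‖ ^ 2 + ‖φ i 1‖ ^ 2 = 1)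
    (hψ : ∀ x, ψ x = ∏ i, φ i (x i)) (i : Fin N) :
    expZ ψ i = ∑ b, qubitSign b * ‖φ i b‖ ^ 2 := by
  have h := sum_prod_mul_prod_eq (fun i b => ‖φ i b‖ ^ 2) (by simpa using hφ) qubitSign {i}
  simpa only [expZ, hψ, norm_prod, Finset.prod_pow, Finset.prod_singleton] using h

theorem expZZ_of_product (hφ : ∀ i, ‖φ i 0‖ ^ 2 + ‖φ i 1‖ ^ 2 = 1)
    (hψ : ∀ x, ψ x = ∏ i, φ i (x i)) {i j : Fin N} (hij : i ≠ j) :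
    expZZ ψ i j = expZ ψ i * expZ ψ j := by
  have h := sum_prod_mul_prod_eq (fun i b => ‖φ i b‖ ^ 2) (by simpa using hφ) qubitSign {i, j}
  rw [expZ_of_product hφ hψ, expZ_of_product hφ hψ]
  simpa only [expZZ, hψ, norm_prod, Finset.prod_pow, Finset.prod_pair hij] using h

theorem qfim_of_product (hφ : ∀ i, ‖φ i 0‖ ^ 2 + ‖φ i 1‖ ^ 2 = 1)
    (hψ : ∀ x, ψ x = ∏ i, φ i (x i)) :
    qfim ψ = Matrix.diagonal fun i => 4 * (1 - expZ ψ i ^ 2) := by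
  ext i j
  by_cases hij : i = j
  · simp [qfim, hij]
  · simp [qfim, hij, expZZ_of_product hφ hψ hij]

end ProductState

theorem trace_weightW_mul_diagonal_inv {N : ℕ} (α : ℝ) {d : Fin N → ℝ} (hd : ∀ i, d i ≠ 0) :
    Matrix.trace (weightW N α * (Matrix.diagonal d)⁻¹)
      = ∑ i, (16 * (((N : ℝ) - 1) * α ^ 2 + 1)) / d i := by
  have hinv : (Matrix.diagonal d)⁻¹ = Matrix.diagonal fun i => (d i)⁻¹ := by
    refine Matrix.inv_eq_right_inv ?_
    simp [Matrix.diagonal_mul_diagonal, hd]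
  simp [hinv, Matrix.trace, weightW, div_eq_mul_inv]

/-- Theorem 4: for a fully product `N`-qubit pure state `ψ(x) = ∏_i φ_i(x_i)`,
the QFIM is diagonal with `F_ii = 4(1 − E_ψ[Z_i]²)`; if moreover `E_ψ[Z_i]² < 1`
for all `i`, then `Tr(W̄ F(ψ)⁻¹) = Σ_i a/(4(1 − E_ψ[Z_i]²)) ≥ N a/4
= 4N[(N−1)α² + 1]`, where `a = 16[(N−1)α² + 1]`. -/
theorem product_probe_precision_bound
    {N : ℕ} (hN : 1 ≤ N) (α : ℝ) (hα0 : 0 < α) (hα1 : α < 1)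
    (φ : Fin N → Fin 2 → ℂ) (hφ : ∀ i, ‖φ i 0‖ ^ 2 + ‖φ i 1‖ ^ 2 = 1)
    (ψ : (Fin N → Fin 2) → ℂ)
    (hψdef : ∀ x : Fin N → Fin 2, ψ x = ∏ i, φ i (x i)) :
    (∀ i j, i ≠ j → qfim ψ i j = 0) ∧
    (∀ i, qfim ψ i i = 4 * (1 - expZ ψ i ^ 2)) ∧
    ((∀ i, expZ ψ i ^ 2 < 1) →
      Matrix.trace (weightW N α * (qfim ψ)⁻¹)
          = ∑ i, (16 * (((N : ℝ) - 1) * α ^ 2 + 1)) / (4 * (1 - expZ ψ i ^ 2)) ∧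
      (N : ℝ) * (16 * (((N : ℝ) - 1) * α ^ 2 + 1)) / 4
          ≤ ∑ i, (16 * (((N : ℝ) - 1) * α ^ 2 + 1)) / (4 * (1 - expZ ψ i ^ 2)) ∧
      (N : ℝ) * (16 * (((N : ℝ) - 1) * α ^ 2 + 1)) / 4
          = 4 * (N : ℝ) * (((N : ℝ) - 1) * α ^ 2 + 1)) := by
  have hF := qfim_of_product hφ hψdef
  refine ⟨fun i j hij => by simp [hF, hij], fun i => by simp [hF], fun hlt => ⟨?_, ?_, by ring⟩⟩
  · rw [hF]
    exact trace_weightW_mul_diagonal_inv α fun i => by linarith [hlt i]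
  · have hN' : (1 : ℝ) ≤ N := by exact_mod_cast hN
    have ha : 0 ≤ 16 * (((N : ℝ) - 1) * α ^ 2 + 1) := by
      have := mul_nonneg (sub_nonneg.2 hN') (sq_nonneg α)
      linarith
    calc (N : ℝ) * (16 * (((N : ℝ) - 1) * α ^ 2 + 1)) / 4
        = ∑ _i : Fin N, (16 * (((N : ℝ) - 1) * α ^ 2 + 1)) / 4 := by
          simp [mul_div_assoc]
      _ ≤ _ := Finset.sum_le_sum fun i _ =>
          div_le_div_of_nonneg_left ha (by linarith [hlt i]) (by linarith [sq_nonneg (expZ ψ i)])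
end

section
/- (Identity weight matrix does not require entanglement) Let N ≥ 1. (i) For every N-qubit pure state ψ whose QFIM F(ψ) is positive definite, Tr(F(ψ)⁻¹) ≥ N/4. (ii) The uniform product state ψ₀ with ψ₀(x) = 2^{−N/2} for all x satisfies E_{ψ₀}[Z_i] = 0 for all i and E_{ψ₀}[Z_i Z_j] = 0 for all i ≠ j, so F(ψ₀) = 4·I and Tr(F(ψ₀)⁻¹) = N/4. Hence for the weight matrix W = I the optimized bound is attained by a pure product probe. -/
open scoped BigOperators

/-- Convexity bound for the trace of the inverse of a positive definite matrix, from expanding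
the positive semidefinite matrix `(1 - cA) A⁻¹ (1 - cA)`. -/
theorem Matrix.PosDef.le_trace_inv {n : Type*} [Fintype n] [DecidableEq n]
    {A : Matrix n n ℝ} (hA : A.PosDef) (c : ℝ) :
    2 * c * (Fintype.card n : ℝ) - c ^ 2 * A.trace ≤ A⁻¹.trace := by
  have hdet : IsUnit A.det := (Matrix.isUnit_iff_isUnit_det A).mp hA.isUnit
  have hH : (1 - c • A).conjTranspose = 1 - c • A := by
    rw [Matrix.conjTranspose_sub, Matrix.conjTranspose_smul, hA.isHermitian.eq,
      Matrix.conjTranspose_one, star_trivial]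
  have hps := hA.inv.posSemidef.conjTranspose_mul_mul_same (1 - c • A)
  have hexp : (1 - c • A) * A⁻¹ * (1 - c • A)
      = A⁻¹ - (2 * c) • (1 : Matrix n n ℝ) + c ^ 2 • A := by
    simp only [Matrix.sub_mul, Matrix.mul_sub, Matrix.one_mul, Matrix.mul_one, Matrix.smul_mul,
      Matrix.mul_smul, Matrix.mul_nonsing_inv A hdet, Matrix.nonsing_inv_mul A hdet]
    module
  rw [hH, hexp] at hps
  have htr := hps.trace_nonneg
  simp only [Matrix.trace_add, Matrix.trace_sub, Matrix.trace_smul, Matrix.trace_one,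
    smul_eq_mul] at htr
  linarith

theorem qubitSign_add_one (b : Fin 2) : qubitSign (b + 1) = -qubitSign b := by
  fin_cases b <;> simp [qubitSign]

/-- A function of bit strings that is odd under flipping the bit `i` sums to zero. -/
theorem sum_eq_zero_of_flip_odd {N : ℕ} (i : Fin N) (f : (Fin N → Fin 2) → ℝ)
    (hf : ∀ x, f (Function.update x i (x i + 1)) = -f x) : ∑ x, f x = 0 := by
  have hinv : Function.Involutive
      (fun x : Fin N → Fin 2 => Function.update x i (x i + 1)) := by
    intro x
    have h : ∀ b : Fin 2, b + 1 + 1 = b := by decide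
    simp [h]
  have hsum := Equiv.sum_comp hinv.toPerm f
  simp only [Function.Involutive.coe_toPerm, hf, Finset.sum_neg_distrib] at hsum
  linarith

theorem expZ_eq_zero_of_const {N : ℕ} {ψ : (Fin N → Fin 2) → ℂ} {c : ℂ}
    (hψ : ∀ x, ψ x = c) (i : Fin N) : expZ ψ i = 0 := by
  refine sum_eq_zero_of_flip_odd i _ fun x => ?_
  simp [hψ, qubitSign_add_one]

theorem expZZ_eq_zero_of_const {N : ℕ} {ψ : (Fin N → Fin 2) → ℂ} {c : ℂ}
    (hψ : ∀ x, ψ x = c) {i j : Fin N} (hij : i ≠ j) : expZZ ψ i j = 0 := by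
  refine sum_eq_zero_of_flip_odd i _ fun x => ?_
  simp [hψ, qubitSign_add_one, Function.update_of_ne hij.symm]

theorem qfim_eq_of_const {N : ℕ} {ψ : (Fin N → Fin 2) → ℂ} {c : ℂ}
    (hψ : ∀ x, ψ x = c) : qfim ψ = (4 : ℝ) • (1 : Matrix (Fin N) (Fin N) ℝ) := by
  ext i j
  by_cases hij : i = j
  · subst hij
    simp [qfim, expZ_eq_zero_of_const hψ]
  · simp [qfim, hij, expZ_eq_zero_of_const hψ, expZZ_eq_zero_of_const hψ hij]

/-- Identity weight matrix does not require entanglement: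
(i) every `N`-qubit pure probe `ψ` with positive definite QFIM satisfies
`Tr(F(ψ)⁻¹) ≥ N/4`; (ii) the uniform product state `ψ₀(x) = 2^{−N/2}` has
`E[Z_i] = 0`, `E[Z_i Z_j] = 0` for `i ≠ j`, `F(ψ₀) = 4·I` and
`Tr(F(ψ₀)⁻¹) = N/4`, so for `W = I` the optimized bound is attained by a pure
product probe. -/
theorem identity_weight_bound_attained_by_product
    {N : ℕ} (hN : 1 ≤ N) :
    (∀ ψ : (Fin N → Fin 2) → ℂ, (∑ x : Fin N → Fin 2, ‖ψ x‖ ^ 2 = 1) →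
      (qfim ψ).PosDef → (N : ℝ) / 4 ≤ Matrix.trace (qfim ψ)⁻¹) ∧
    (∀ ψ₀ : (Fin N → Fin 2) → ℂ,
      (∀ x : Fin N → Fin 2, ψ₀ x = Complex.ofReal ((2 : ℝ) ^ (-(N : ℝ) / 2))) →
        (∀ i, expZ ψ₀ i = 0) ∧
        (∀ i j, i ≠ j → expZZ ψ₀ i j = 0) ∧
        qfim ψ₀ = (4 : ℝ) • (1 : Matrix (Fin N) (Fin N) ℝ) ∧
        Matrix.trace (qfim ψ₀)⁻¹ = (N : ℝ) / 4) := by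
  refine ⟨fun ψ _ hpos => ?_, fun ψ₀ hψ => ?_⟩
  · have h := hpos.le_trace_inv (1 / 4)
    have htr := trace_qfim_le ψ
    rw [Fintype.card_fin] at h
    linarith
  · have hF := qfim_eq_of_const hψ
    refine ⟨expZ_eq_zero_of_const hψ, fun i j => expZZ_eq_zero_of_const hψ, hF, ?_⟩
    have hinv : (qfim ψ₀)⁻¹ = (4 : ℝ)⁻¹ • (1 : Matrix (Fin N) (Fin N) ℝ) := by
      rw [hF]
      exact Matrix.inv_eq_right_inv (by simp [smul_smul])
    rw [hinv, Matrix.trace_smul, Matrix.trace_one, Fintype.card_fin, smul_eq_mul]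
    ring
end

section
/- (Key inequality in the proof of Theorem 5) Let d ≥ 1, let η : Fin d → ℝ with η_n ≥ 0 for all n and Σ_n η_n = 1 (the eigenvalues of a density matrix), and let B be a d×d Hermitian complex matrix (the generator expressed in the eigenbasis of the density matrix). Let η_M = max_n η_n, η_m = min_n η_n, and r = (η_M − η_m)²/(η_M + η_m)². Define the SLD quantum Fisher information-type quantity S = Σ_{n ≠ n', η_n + η_{n'} ≠ 0} 4 η_n ((η_{n'} − η_n)/(η_n + η_{n'}))² |B_{n n'}|², and the variance V = Σ_n η_n (B²)_{nn} − (Σ_n η_n B_{nn})² (both diagonal entries of B and B² are real since B is Hermitian). Then S ≤ 4rV, and since r ≤ 1 also S ≤ 4V. -/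
/-- The relative difference of two numbers in `[m, M]` is at most that of the endpoints. -/
theorem sq_sub_div_add_le {m M a b : ℝ} (hm : 0 ≤ m) (hma : m ≤ a) (hmb : m ≤ b)
    (haM : a ≤ M) (hbM : b ≤ M) (hab : a + b ≠ 0) :
    ((b - a) / (a + b)) ^ 2 ≤ (M - m) ^ 2 / (M + m) ^ 2 := by
  have hpos : 0 < a + b := lt_of_le_of_ne (by linarith) hab.symm
  have hMm : 0 < M + m := by linarith
  have h₁ : b * m ≤ M * a := mul_le_mul hbM hma hm (by linarith)
  have h₂ : a * m ≤ M * b := mul_le_mul haM hmb hm (by linarith)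
  rw [← div_pow, sq_le_sq, abs_of_nonneg (div_nonneg (by linarith) hMm.le : 0 ≤ (M - m) / (M + m)),
    abs_le]
  constructor
  · rw [← neg_div, div_le_div_iff₀ hMm hpos]
    nlinarith
  · rw [div_le_div_iff₀ hpos hMm]
    nlinarith

/-- The diagonal entries of the square of a Hermitian matrix are the squared row norms. -/
theorem Matrix.IsHermitian.re_mul_self_apply {ι : Type*} [Fintype ι] {B : Matrix ι ι ℂ}
    (hB : B.IsHermitian) (n : ι) : ((B * B) n n).re = ∑ k, ‖B n k‖ ^ 2 := by
  rw [Matrix.mul_apply, Complex.re_sum]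
  refine Finset.sum_congr rfl fun k _ => ?_
  rw [← hB.apply k n, Complex.star_def, Complex.mul_conj, Complex.ofReal_re,
    Complex.normSq_eq_norm_sq]

/-- The variance of a Hermitian matrix dominates the off-diagonal contribution. -/
theorem Matrix.IsHermitian.sum_offDiag_le_variance {ι : Type*} [Fintype ι] [DecidableEq ι]
    {B : Matrix ι ι ℂ} (hB : B.IsHermitian) {η : ι → ℝ} (hη : ∀ n, 0 ≤ η n)
    (hsum : ∑ n, η n = 1) :
    ∑ n, ∑ k, (if n ≠ k then η n * ‖B n k‖ ^ 2 else 0) ≤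
      ∑ n, η n * ((B * B) n n).re - (∑ n, η n * (B n n).re) ^ 2 := by
  have hjensen : (∑ n, η n * (B n n).re) ^ 2 ≤ ∑ n, η n * (B n n).re ^ 2 :=
    Real.pow_arith_mean_le_arith_mean_pow_of_even _ _ _ (fun n _ => hη n) hsum even_two
  have hdiag : ∑ n, η n * (B n n).re ^ 2 ≤ ∑ n, η n * ‖B n n‖ ^ 2 :=
    Finset.sum_le_sum fun n _ => mul_le_mul_of_nonneg_left
      (sq_le_sq.mpr (by simpa using Complex.abs_re_le_norm (B n n))) (hη n)
  have hsplit : ∑ n, η n * ((B * B) n n).re =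
      ∑ n, ∑ k, (if n ≠ k then η n * ‖B n k‖ ^ 2 else 0) + ∑ n, η n * ‖B n n‖ ^ 2 := by
    rw [← Finset.sum_add_distrib]
    refine Finset.sum_congr rfl fun n _ => ?_
    have hrow : η n * ‖B n n‖ ^ 2 = ∑ k, if n = k then η n * ‖B n k‖ ^ 2 else 0 := by simp
    rw [hB.re_mul_self_apply, Finset.mul_sum, hrow, ← Finset.sum_add_distrib]
    refine Finset.sum_congr rfl fun k _ => ?_
    by_cases h : n = k <;> simp [h]
  linarith


/-- Key inequality in the proof of Theorem 5: for a density-matrix spectrum `η`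
(`η_n ≥ 0`, `Σ η_n = 1`) and a Hermitian generator `B` expressed in its eigenbasis,
the SLD quantum Fisher information-type quantity
`S = Σ_{n ≠ n', η_n + η_{n'} ≠ 0} 4 η_n ((η_{n'} − η_n)/(η_n + η_{n'}))² |B_{n n'}|²`
satisfies `S ≤ 4 r V ≤ 4 V`, where `r = (η_M − η_m)²/(η_M + η_m)²` and `V` is the
variance `Σ_n η_n (B²)_{nn} − (Σ_n η_n B_{nn})²`. -/
theorem sld_qfi_le_four_r_mul_variance
    {d : ℕ} (hd : 1 ≤ d) (η : Fin d → ℝ)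
    (hη : ∀ n, 0 ≤ η n) (hsum : ∑ n, η n = 1)
    (B : Matrix (Fin d) (Fin d) ℂ) (hB : B.IsHermitian) :
    letI hne : (Finset.univ : Finset (Fin d)).Nonempty :=
      Finset.univ_nonempty_iff.mpr (Fin.pos_iff_nonempty.mp hd)
    letI ηM : ℝ := Finset.univ.sup' hne η
    letI ηm : ℝ := Finset.univ.inf' hne η
    letI r : ℝ := (ηM - ηm) ^ 2 / (ηM + ηm) ^ 2
    letI S : ℝ := ∑ n, ∑ n',
      if n ≠ n' ∧ η n + η n' ≠ 0 then
        4 * η n * ((η n' - η n) / (η n + η n')) ^ 2 * ‖B n n'‖ ^ 2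
      else 0
    letI V : ℝ := ∑ n, η n * ((B * B) n n).re - (∑ n, η n * (B n n).re) ^ 2
    S ≤ 4 * r * V ∧ S ≤ 4 * V := by
  have hne : (Finset.univ : Finset (Fin d)).Nonempty := ⟨⟨0, hd⟩, Finset.mem_univ _⟩
  set ηM : ℝ := Finset.univ.sup' hne η
  set ηm : ℝ := Finset.univ.inf' hne η
  set r : ℝ := (ηM - ηm) ^ 2 / (ηM + ηm) ^ 2
  set S : ℝ := ∑ n, ∑ n',
    if n ≠ n' ∧ η n + η n' ≠ 0 then
      4 * η n * ((η n' - η n) / (η n + η n')) ^ 2 * ‖B n n'‖ ^ 2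
    else 0
  set V : ℝ := ∑ n, η n * ((B * B) n n).re - (∑ n, η n * (B n n).re) ^ 2
  have hM (n : Fin d) : η n ≤ ηM := Finset.le_sup' η (Finset.mem_univ n)
  have hm (n : Fin d) : ηm ≤ η n := Finset.inf'_le η (Finset.mem_univ n)
  have hm0 : 0 ≤ ηm := Finset.le_inf' hne η fun n _ => hη n
  have hmM : ηm ≤ ηM := (hm ⟨0, hd⟩).trans (hM ⟨0, hd⟩)
  have hr0 : 0 ≤ r := by positivity
  have hr1 : r ≤ 1 := div_le_one_of_le₀
    (pow_le_pow_left₀ (by linarith) (by linarith) 2) (by positivity)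
  set W : ℝ := ∑ n, ∑ k, (if n ≠ k then η n * ‖B n k‖ ^ 2 else 0) with hW
  have hWV : W ≤ V := hB.sum_offDiag_le_variance hη hsum
  have hW0 : 0 ≤ W := Finset.sum_nonneg fun n _ => Finset.sum_nonneg fun k _ => by
    have := hη n
    split_ifs <;> positivity
  have hSW : S ≤ 4 * r * W := by
    rw [hW, Finset.mul_sum]
    refine Finset.sum_le_sum fun n _ => ?_
    rw [Finset.mul_sum]
    refine Finset.sum_le_sum fun k _ => ?_
    have hn := hη n
    by_cases hnk : n = k
    · simp [hnk]
    by_cases hs : η n + η k = 0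
    · simp only [hs, hnk, ne_eq, not_true_eq_false, and_false, if_false, not_false_eq_true, if_true]
      positivity
    · rw [if_pos ⟨hnk, hs⟩, if_pos hnk]
      have hratio : ((η k - η n) / (η n + η k)) ^ 2 ≤ r :=
        sq_sub_div_add_le hm0 (hm n) (hm k) (hM n) (hM k) hs
      calc 4 * η n * ((η k - η n) / (η n + η k)) ^ 2 * ‖B n k‖ ^ 2
          ≤ 4 * η n * r * ‖B n k‖ ^ 2 := by gcongr
        _ = 4 * r * (η n * ‖B n k‖ ^ 2) := by ring
  have hSV : S ≤ 4 * r * V := hSW.trans (mul_le_mul_of_nonneg_left hWV (by positivity))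
  exact ⟨hSV, hSV.trans (mul_le_mul_of_nonneg_right (by linarith) (hW0.trans hWV))⟩
end
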